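/- Let 𝒰 ⊆ ℝ, let f : 𝒰^n → ℝ have M = M_Lip(f) and J = J_Lip(f) finite, let ℋ be a finite class of functions h : 𝒳 → 𝒰, and fix x, x′ ∈ 𝒳^n. Then for all h, g ∈ ℋ, Σ_{k=1}^n ‖ v^k(h(x), h(x′)) − v^k(g(x), g(x′)) ‖² ≤ (4M² + J²) · Σ_{k=1}^n ( |h(x_k) − g(x_k)|² + |h(x′_k) − g(x′_k)|² ), where ‖·‖ is the Euclidean norm on ℝ^{2n}. (Consequently, the Gaussian process Ω_h = Σ_{k=1}^n ⟨γ_k, v^k(h(x), h(x′))⟩, with γ_1,…,γ_n independent standard Gaussian vectors in ℝ^{2n}, satisfies E(Ω_h − Ω_g)² ≤ E(Ξ_h − Ξ_g)² for the Gaussian process Ξ_h = √(4M² + J²) Σ_{k=1}^n ( γ_k h(x_k) + γ′_k h(x′_k) ) with independent standard normals γ_k, γ′_k.) -/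

import Mathlib

/-- The `k`-th partial difference operator:
`D^k_{y,y'} f(x) = f(…,x_{k-1},y,x_{k+1},…) - f(…,x_{k-1},y',x_{k+1},…)`. -/
def pdiff {α : Type*} {n : ℕ} (f : (Fin n → α) → ℝ) (k : Fin n) (y y' : α)
    (x : Fin n → α) : ℝ :=
  f (Function.update x k y) - f (Function.update x k y')

/-- The vector `v^k(x,x') ∈ ℝ^{2n}` (indexed by `Fin n ⊕ Fin n`): its `i`-th component is
`2M x_k` if `i = k`, `J n^{-1/2} x_i` if `i ≤ n`, `i ≠ k`, `2M x'_k` if `i = n + k` and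
`J n^{-1/2} x'_{i-n}` if `i > n`, `i ≠ n + k`. -/
noncomputable def vK {n : ℕ} (M J : ℝ) (k : Fin n) (x x' : Fin n → ℝ) :
    (Fin n ⊕ Fin n) → ℝ :=
  Sum.elim (fun i => if i = k then 2 * M * x k else J / Real.sqrt n * x i)
    (fun i => if i = k then 2 * M * x' k else J / Real.sqrt n * x' i)

theorem vK_aux {n : ℕ} (M J : ℝ) (a b : Fin n → ℝ) :
    ∑ k : Fin n, ∑ i : Fin n,
      ((if i = k then 2 * M * a k else J / Real.sqrt n * a i) -
        (if i = k then 2 * M * b k else J / Real.sqrt n * b i)) ^ 2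
      ≤ (4 * M ^ 2 + J ^ 2) * ∑ k : Fin n, |a k - b k| ^ 2 := by
  rcases Nat.eq_zero_or_pos n with rfl | hn
  · simp
  have hn' : (0 : ℝ) < n := by exact_mod_cast hn
  have h1 : ∀ k i : Fin n,
      ((if i = k then 2 * M * a k else J / Real.sqrt n * a i) -
        (if i = k then 2 * M * b k else J / Real.sqrt n * b i)) ^ 2
      ≤ (if i = k then 4 * M ^ 2 * |a k - b k| ^ 2 else 0) + J ^ 2 / n * |a i - b i| ^ 2 := by
    intro k i
    have h0 : 0 ≤ J ^ 2 / n * |a i - b i| ^ 2 := by positivity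
    by_cases h : i = k
    · simp only [h, if_true, sq_abs] at h0 ⊢
      nlinarith
    · simp only [h, if_false, sq_abs]
      rw [← mul_sub, mul_pow, div_pow, Real.sq_sqrt hn'.le, zero_add]
  refine (Finset.sum_le_sum fun k _ => Finset.sum_le_sum fun i _ => h1 k i).trans (le_of_eq ?_)
  simp only [Finset.sum_add_distrib, Finset.sum_ite_eq', Finset.mem_univ, if_true,
    ← Finset.mul_sum, Finset.sum_const, Finset.card_univ, Fintype.card_fin, nsmul_eq_mul]
  field_simp

/-- With `M = M_Lip(f)` and `J = J_Lip(f)`, for all `h, g` in the class,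
`∑_k ‖v^k(h(x),h(x')) - v^k(g(x),g(x'))‖² ≤
  (4M² + J²) ∑_k (|h(x_k) - g(x_k)|² + |h(x'_k) - g(x'_k)|²)`. -/
theorem vK_distance_bound {𝒳 : Type*} {n : ℕ} (U : Set ℝ) (f : (Fin n → ℝ) → ℝ)
    (M J : ℝ)
    (hM : ∀ (x : Fin n → ℝ), (∀ i, x i ∈ U) →
      ∀ (k : Fin n) (y y' : ℝ), y ∈ U → y' ∈ U →
      pdiff f k y y' x ≤ M * |y - y'|)
    (hJ : ∀ (k l : Fin n), k ≠ l →
      ∀ (x : Fin n → ℝ), (∀ i, x i ∈ U) →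
      ∀ (y y' z z' : ℝ), y ∈ U → y' ∈ U → z ∈ U → z' ∈ U →
      pdiff (fun w => pdiff f k y y' w) l z z' x ≤ (J / n) * |y - y'|)
    {ι : Type*} [Fintype ι] [Nonempty ι]
    (H : ι → 𝒳 → ℝ) (hHU : ∀ i x, H i x ∈ U)
    (x x' : Fin n → 𝒳) :
    ∀ h g : ι,
      ∑ k : Fin n, ∑ i : Fin n ⊕ Fin n,
        (vK M J k (fun j => H h (x j)) (fun j => H h (x' j)) i -
          vK M J k (fun j => H g (x j)) (fun j => H g (x' j)) i) ^ 2
      ≤ (4 * M ^ 2 + J ^ 2) *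
        ∑ k : Fin n, (|H h (x k) - H g (x k)| ^ 2 + |H h (x' k) - H g (x' k)| ^ 2) := by
  intro h g
  simp only [vK, Fintype.sum_sum_type, Sum.elim_inl, Sum.elim_inr]
  rw [Finset.sum_add_distrib, Finset.sum_add_distrib, mul_add]
  exact add_le_add (vK_aux M J _ _) (vK_aux M J _ _)
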